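/- Let X be a countable set, K a stochastic matrix on X (K(x,y) ≥ 0 and Σ_y K(x,y) = 1 for all x) with stationary probability distribution π (Σ_x π(x)K(x,y) = π(y)), and define d_H(m) = sup_{x∈X} (½ Σ_{y∈X} (√(K^m(x,y)) − √(π(y)))²)^{1/2}. Then the map m ↦ 4 d_H(m) is non-increasing and submultiplicative; in particular d_H(n+m) ≤ 4 d_H(n) d_H(m) for all nonnegative integers n, m. -/

import Mathlib

open scoped BigOperators

/-- `m`-step transition probabilities of a Markov kernel on a countable set. -/
noncomputable def kernelPow {X : Type*} [DecidableEq X] (K : X → X → ℝ) : ℕ → X → X → ℝ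
  | 0 => fun x y => if x = y then 1 else 0
  | m + 1 => fun x y => ∑' z, kernelPow K m x z * K z y

/-- Maximum Hellinger distance between the rows of `P` and `π`. -/
noncomputable def hellingerSup {X : Type*} (P : X → X → ℝ) (π : X → ℝ) : ℝ :=
  ⨆ x : X, Real.sqrt ((1 / 2) * ∑' y, (Real.sqrt (P x y) - Real.sqrt (π y)) ^ 2)

/-- Tonelli for nonnegative double series, in terms of `HasSum`. -/
theorem hasSum_swap_of_nonneg {X Y : Type*} {F : X → Y → ℝ} (h0 : ∀ y z, 0 ≤ F y z)
    {R : X → ℝ} (hR : ∀ y, HasSum (F y) (R y)) {T : ℝ} (hT : HasSum R T) :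
    (∀ z, Summable fun y => F y z) ∧ HasSum (fun z => ∑' y, F y z) T := by
  have hs : Summable (fun p : X × Y => F p.1 p.2) := by
    refine (summable_prod_of_nonneg fun p => h0 p.1 p.2).2 ⟨fun y => (hR y).summable, ?_⟩
    simpa only [(hR _).tsum_eq] using hT.summable
  have hsum : HasSum (fun p : X × Y => F p.1 p.2) T := by
    have h := hs.hasSum.prod_fiberwise hR
    rw [hT.unique h]
    exact hs.hasSum
  have hswap : HasSum (fun p : Y × X => F p.2 p.1) T :=
    (Equiv.prodComm Y X).hasSum_iff.2 hsum
  have hcol : ∀ z, Summable fun y => F y z := fun z => hswap.summable.prod_factor z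
  exact ⟨hcol, hswap.prod_fiberwise fun z => (hcol z).hasSum⟩

theorem HasSum.sq_le_mul_of_sq {X : Type*} {f g : X → ℝ} {A B C : ℝ}
    (hf : HasSum (fun x => f x ^ 2) A) (hg : HasSum (fun x => g x ^ 2) B)
    (hfg : HasSum (fun x => f x * g x) C) : C ^ 2 ≤ A * B := by
  have key : ∀ t : ℝ, 0 ≤ B * (t * t) + (-2 * C) * t + A := by
    intro t
    have h : HasSum (fun x => (f x - t * g x) ^ 2) (A - 2 * t * C + t ^ 2 * B) := by
      refine HasSum.congr_fun
        ((hf.sub (hfg.mul_left (2 * t))).add (hg.mul_left (t ^ 2))) fun x => ?_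
      ring
    have := h.nonneg fun x => sq_nonneg _
    linarith
  have := discrim_le_zero key
  unfold discrim at this
  linarith

theorem exists_hasSum_mul_le_sqrt_mul_sqrt {X : Type*} {f g : X → ℝ} {A B : ℝ}
    (hf : HasSum (fun x => f x ^ 2) A) (hg : HasSum (fun x => g x ^ 2) B) :
    ∃ C, HasSum (fun x => f x * g x) C ∧ C ≤ √A * √B := by
  have hs : Summable fun x => f x * g x := by
    refine Summable.of_norm_bounded (hf.summable.add hg.summable) fun x => ?_
    rw [Real.norm_eq_abs, abs_le]
    constructor <;> nlinarith [sq_nonneg (f x - g x), sq_nonneg (f x + g x)]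
  refine ⟨_, hs.hasSum, ?_⟩
  rw [← Real.sqrt_mul (hf.nonneg fun x => sq_nonneg _)]
  exact Real.le_sqrt_of_sq_le (hf.sq_le_mul_of_sq hg hs.hasSum)

/-- Probability vectors on a discrete set. -/
structure IsProbVec {X : Type*} (μ : X → ℝ) : Prop where
  nonneg : ∀ x, 0 ≤ μ x
  hasSum : HasSum μ 1

/-- The law obtained from `μ` by one step of the kernel `P`. -/
noncomputable def kernelPush {X : Type*} (μ : X → ℝ) (P : X → X → ℝ) : X → ℝ :=
  fun z => ∑' y, μ y * P y z

/-- Twice the squared Hellinger distance. -/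
noncomputable def hellingerEnergy {X : Type*} (μ ν : X → ℝ) : ℝ :=
  ∑' y, (√(μ y) - √(ν y)) ^ 2

section Push

variable {X : Type*} {μ ν : X → ℝ} {P Q : X → X → ℝ}

theorem kernelPush_summable_and_hasSum (hμ : IsProbVec μ) (hP : ∀ x, IsProbVec (P x)) :
    (∀ z, Summable fun y => μ y * P y z) ∧ HasSum (kernelPush μ P) 1 :=
  hasSum_swap_of_nonneg (fun y z => mul_nonneg (hμ.nonneg y) ((hP y).nonneg z))
    (fun y => by simpa using (hP y).hasSum.mul_left (μ y)) hμ.hasSum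

theorem IsProbVec.hasSum_kernelPush (hμ : IsProbVec μ) (hP : ∀ x, IsProbVec (P x)) (z : X) :
    HasSum (fun y => μ y * P y z) (kernelPush μ P z) :=
  ((kernelPush_summable_and_hasSum hμ hP).1 z).hasSum

theorem IsProbVec.isProbVec_kernelPush (hμ : IsProbVec μ) (hP : ∀ x, IsProbVec (P x)) :
    IsProbVec (kernelPush μ P) :=
  ⟨fun z => (hμ.hasSum_kernelPush hP z).nonneg
    fun y => mul_nonneg (hμ.nonneg y) ((hP y).nonneg z),
    (kernelPush_summable_and_hasSum hμ hP).2⟩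

theorem IsProbVec.kernelPush_assoc (hμ : IsProbVec μ) (hP : ∀ x, IsProbVec (P x))
    (hQ : ∀ x, IsProbVec (Q x)) :
    kernelPush (kernelPush μ P) Q =
      kernelPush μ (fun y => kernelPush (P y) Q) := by
  funext z
  have hR : ∀ y, HasSum (fun w => μ y * (P y w * Q w z)) (μ y * kernelPush (P y) Q z) :=
    fun y => ((hP y).hasSum_kernelPush hQ z).mul_left (μ y)
  have hT := hμ.hasSum_kernelPush (fun y => (hP y).isProbVec_kernelPush hQ) z
  have h := (hasSum_swap_of_nonneg (fun y w => mul_nonneg (hμ.nonneg y)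
    (mul_nonneg ((hP y).nonneg w) ((hQ w).nonneg z))) hR hT).2
  rw [← h.tsum_eq]
  refine tsum_congr fun w => ?_
  simp only [kernelPush, ← tsum_mul_right, mul_assoc]

theorem IsProbVec.hasSum_sq_sqrt (hμ : IsProbVec μ) : HasSum (fun y => √(μ y) ^ 2) 1 := by
  simpa only [Real.sq_sqrt (hμ.nonneg _)] using hμ.hasSum

theorem IsProbVec.hasSum_hellingerEnergy (hμ : IsProbVec μ) (hν : IsProbVec ν) :
    HasSum (fun y => (√(μ y) - √(ν y)) ^ 2) (hellingerEnergy μ ν) := by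
  refine (Summable.of_nonneg_of_le (fun y => sq_nonneg _) (fun y => ?_)
    (hμ.hasSum.add hν.hasSum).summable).hasSum
  have h1 := Real.sq_sqrt (hμ.nonneg y)
  have h2 := Real.sq_sqrt (hν.nonneg y)
  nlinarith [mul_nonneg (Real.sqrt_nonneg (μ y)) (Real.sqrt_nonneg (ν y))]

theorem hellingerEnergy_nonneg (μ ν : X → ℝ) : 0 ≤ hellingerEnergy μ ν :=
  tsum_nonneg fun _ => sq_nonneg _

theorem IsProbVec.hellingerEnergy_le_two (hμ : IsProbVec μ) (hν : IsProbVec ν) :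
    hellingerEnergy μ ν ≤ 2 := by
  have h := hasSum_le (fun y => ?_) (hμ.hasSum_hellingerEnergy hν) (hμ.hasSum.add hν.hasSum)
  · linarith
  have h1 := Real.sq_sqrt (hμ.nonneg y)
  have h2 := Real.sq_sqrt (hν.nonneg y)
  nlinarith [mul_nonneg (Real.sqrt_nonneg (μ y)) (Real.sqrt_nonneg (ν y))]

/-- Data processing inequality for the Hellinger distance. -/
theorem IsProbVec.hellingerEnergy_kernelPush_le (hμ : IsProbVec μ) (hν : IsProbVec ν)
    (hP : ∀ x, IsProbVec (P x)) :
    hellingerEnergy (kernelPush μ P) (kernelPush ν P) ≤ hellingerEnergy μ ν := by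
  obtain ⟨-, hT⟩ := hasSum_swap_of_nonneg
    (F := fun y z => (√(μ y) - √(ν y)) ^ 2 * P y z)
    (fun y z => mul_nonneg (sq_nonneg _) ((hP y).nonneg z))
    (fun y => by simpa using (hP y).hasSum.mul_left ((√(μ y) - √(ν y)) ^ 2))
    (hμ.hasSum_hellingerEnergy hν)
  refine hasSum_le (fun z => ?_)
    ((hμ.isProbVec_kernelPush hP).hasSum_hellingerEnergy (hν.isProbVec_kernelPush hP)) hT
  have hsq : ∀ {ρ : X → ℝ}, IsProbVec ρ →
      HasSum (fun y => (√(ρ y) * √(P y z)) ^ 2) (kernelPush ρ P z) := fun hρ => by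
    simpa only [mul_pow, Real.sq_sqrt (hρ.nonneg _), Real.sq_sqrt ((hP _).nonneg z)]
      using hρ.hasSum_kernelPush hP z
  obtain ⟨C, hC, hCle⟩ := exists_hasSum_mul_le_sqrt_mul_sqrt (hsq hμ) (hsq hν)
  have hF : HasSum (fun y => (√(μ y) - √(ν y)) ^ 2 * P y z)
      (kernelPush μ P z + kernelPush ν P z - 2 * C) := by
    refine HasSum.congr_fun (((hsq hμ).add (hsq hν)).sub (hC.mul_left 2)) fun y => ?_
    linear_combination (-(√(μ y) - √(ν y)) ^ 2) * Real.sq_sqrt ((hP y).nonneg z)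
  rw [hF.tsum_eq]
  linarith [Real.sq_sqrt ((hμ.isProbVec_kernelPush hP).nonneg z),
    Real.sq_sqrt ((hν.isProbVec_kernelPush hP).nonneg z)]

/-- A coordinatewise bound, by Cauchy-Schwarz, for the squared Hellinger increment. -/
theorem IsProbVec.sq_sqrt_sub_sqrt_le (hμ : IsProbVec μ) (hν : IsProbVec ν) {p : X → ℝ}
    (hp : ∀ y, 0 ≤ p y) {u v S : ℝ} (hv0 : 0 ≤ v) (hu : HasSum (fun y => μ y * p y) u)
    (hv : HasSum (fun y => ν y * p y) v)
    (hS : HasSum (fun y => (√(μ y) - √(ν y)) ^ 2 * (√(p y) - √v) ^ 2) S) :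
    (√u - √v) ^ 2 ≤ 8 * S := by
  have hu0 : 0 ≤ u := hu.nonneg fun y => mul_nonneg (hμ.nonneg y) (hp y)
  have hS0 : 0 ≤ S := hS.nonneg fun y => by positivity
  have eμ : ∀ y, √(μ y) ^ 2 = μ y := fun y => Real.sq_sqrt (hμ.nonneg y)
  have eν : ∀ y, √(ν y) ^ 2 = ν y := fun y => Real.sq_sqrt (hν.nonneg y)
  have ep : ∀ y, √(p y) ^ 2 = p y := fun y => Real.sq_sqrt (hp y)
  have eu : √u ^ 2 = u := Real.sq_sqrt hu0
  have ev : √v ^ 2 = v := Real.sq_sqrt hv0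
  have hα := hμ.hasSum_sq_sqrt
  have hβ := hν.hasSum_sq_sqrt
  have hαp : HasSum (fun y => (√(μ y) * √(p y)) ^ 2) u := by simpa only [mul_pow, eμ, ep] using hu
  have hβp : HasSum (fun y => (√(ν y) * √(p y)) ^ 2) v := by simpa only [mul_pow, eν, ep] using hv
  obtain ⟨C₁, h₁, l₁⟩ := exists_hasSum_mul_le_sqrt_mul_sqrt hαp hβp
  obtain ⟨C₂, h₂, l₂⟩ := exists_hasSum_mul_le_sqrt_mul_sqrt hα hβ
  obtain ⟨C₃, h₃, l₃⟩ := exists_hasSum_mul_le_sqrt_mul_sqrt hα hαp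
  obtain ⟨C₄, h₄, l₄⟩ := exists_hasSum_mul_le_sqrt_mul_sqrt hβ hβp
  obtain ⟨C₅, h₅, l₅⟩ := exists_hasSum_mul_le_sqrt_mul_sqrt hβ hαp
  simp only [Real.sqrt_one, one_mul] at l₂ l₃ l₄ l₅
  have hG : HasSum (fun y => ((√(μ y) + √(ν y)) * (√(p y) + √v)) ^ 2)
      (u + v + √v ^ 2 * (1 + 1) + 2 * C₁ + 2 * √v ^ 2 * C₂ + 2 * √v * (C₃ + C₄)
        + 4 * √v * C₅) := by
    convert ((((hαp.add hβp).add ((hα.add hβ).mul_left (√v ^ 2))).add (h₁.mul_left 2)).add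
      (h₂.mul_left (2 * √v ^ 2))).add ((h₃.add h₄).mul_left (2 * √v)) |>.add
      (h₅.mul_left (4 * √v)) using 1
    funext y
    ring
  have hD : HasSum (fun y => ((√(μ y) - √(ν y)) * (√(p y) - √v)) *
      ((√(μ y) + √(ν y)) * (√(p y) + √v))) (u - v) := by
    have h := (hu.sub hv).sub ((hμ.hasSum.sub hν.hasSum).mul_left v)
    rw [sub_self, mul_zero, sub_zero] at h
    refine h.congr_fun fun y => ?_
    linear_combination (√(p y) ^ 2 - √v ^ 2) * (eμ y - eν y) + (μ y - ν y) * (ep y - ev)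
  have hcs := HasSum.sq_le_mul_of_sq (by simpa only [mul_pow] using hS) hG hD
  have su := Real.sqrt_nonneg u
  have sv := Real.sqrt_nonneg v
  have hle : u + v + √v ^ 2 * (1 + 1) + 2 * C₁ + 2 * √v ^ 2 * C₂ + 2 * √v * (C₃ + C₄)
      + 4 * √v * C₅ ≤ 8 * (√u + √v) ^ 2 := by
    nlinarith [mul_le_mul_of_nonneg_left l₂ (sq_nonneg √v), mul_le_mul_of_nonneg_left l₃ sv,
      mul_le_mul_of_nonneg_left l₄ sv, mul_le_mul_of_nonneg_left l₅ sv, mul_nonneg su sv]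
  have hprod : (√u - √v) ^ 2 * (√u + √v) ^ 2 ≤ 8 * S * (√u + √v) ^ 2 := by
    have h := hcs.trans (mul_le_mul_of_nonneg_left hle hS0)
    have e : (√u - √v) ^ 2 * (√u + √v) ^ 2 = (u - v) ^ 2 := by
      rw [← mul_pow, ← eu, ← ev, Real.sqrt_sq su, Real.sqrt_sq sv]
      ring
    rw [e]
    linarith
  rcases (add_nonneg su sv).eq_or_lt with h | h
  · have h1 : √u = 0 := by linarith
    have h2 : √v = 0 := by linarith
    rw [h1, h2]
    linarith
  · exact le_of_mul_le_mul_right hprod (by positivity)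

/-- Contraction of the Hellinger distance to a stationary law `ν` under the kernel `P`. -/
theorem IsProbVec.hellingerEnergy_kernelPush_le_mul (hμ : IsProbVec μ) (hν : IsProbVec ν)
    (hP : ∀ x, IsProbVec (P x)) (hstat : kernelPush ν P = ν) {D : ℝ}
    (hD : ∀ y, hellingerEnergy (P y) ν ≤ D) :
    hellingerEnergy (kernelPush μ P) ν ≤ 8 * (hellingerEnergy μ ν * D) := by
  have hbd := (hμ.hasSum_hellingerEnergy hν).mul_right D
  have hR : Summable fun y => (√(μ y) - √(ν y)) ^ 2 * hellingerEnergy (P y) ν :=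
    Summable.of_nonneg_of_le
      (fun y => mul_nonneg (sq_nonneg _) (hellingerEnergy_nonneg _ _))
      (fun y => mul_le_mul_of_nonneg_left (hD y) (sq_nonneg _)) hbd.summable
  obtain ⟨hcol, hT⟩ := hasSum_swap_of_nonneg
    (F := fun y z => (√(μ y) - √(ν y)) ^ 2 * (√(P y z) - √(ν z)) ^ 2)
    (fun y z => by positivity)
    (fun y => ((hP y).hasSum_hellingerEnergy hν).mul_left _) hR.hasSum
  have hle := hasSum_le (fun y => mul_le_mul_of_nonneg_left (hD y) (sq_nonneg _)) hR.hasSum hbd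
  refine (hasSum_le (fun z => ?_) ((hμ.isProbVec_kernelPush hP).hasSum_hellingerEnergy hν)
    (hT.mul_left 8)).trans (mul_le_mul_of_nonneg_left hle (by norm_num))
  refine hμ.sq_sqrt_sub_sqrt_le hν (fun y => (hP y).nonneg z) (hν.nonneg z)
    (hμ.hasSum_kernelPush hP z) ?_ (hcol z).hasSum
  simpa only [hstat] using hν.hasSum_kernelPush hP z

theorem bddAbove_range_sqrt_hellingerEnergy (hP : ∀ x, IsProbVec (P x)) (hν : IsProbVec ν) :
    BddAbove (Set.range fun x => √(1 / 2 * hellingerEnergy (P x) ν)) := by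
  refine ⟨1, ?_⟩
  rintro _ ⟨x, rfl⟩
  refine Real.sqrt_le_one.2 ?_
  linarith [(hP x).hellingerEnergy_le_two hν]

theorem sqrt_hellingerEnergy_le_hellingerSup (hP : ∀ x, IsProbVec (P x)) (hν : IsProbVec ν)
    (x : X) : √(1 / 2 * hellingerEnergy (P x) ν) ≤ hellingerSup P ν :=
  le_ciSup (bddAbove_range_sqrt_hellingerEnergy hP hν) x

theorem hellingerSup_nonneg (P : X → X → ℝ) (ν : X → ℝ) : 0 ≤ hellingerSup P ν :=
  Real.iSup_nonneg fun _ => Real.sqrt_nonneg _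

theorem hellingerEnergy_le_two_mul_hellingerSup_sq (hP : ∀ x, IsProbVec (P x))
    (hν : IsProbVec ν) (x : X) : hellingerEnergy (P x) ν ≤ 2 * hellingerSup P ν ^ 2 := by
  have h := (Real.sqrt_le_left (hellingerSup_nonneg P ν)).1
    (sqrt_hellingerEnergy_le_hellingerSup hP hν x)
  linarith

end Push

section Pow

variable {X : Type*} [DecidableEq X] {K : X → X → ℝ}

theorem isProbVec_kernelPow (hK : ∀ x, IsProbVec (K x)) (m : ℕ) (x : X) :
    IsProbVec (kernelPow K m x) := by
  induction m with
  | zero =>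
    refine ⟨fun y => ?_, ?_⟩
    · simp only [kernelPow]
      split_ifs <;> norm_num
    · simpa [kernelPow, eq_comm] using hasSum_ite_eq x (1 : ℝ)
  | succ m ih => exact ih.isProbVec_kernelPush hK

theorem kernelPush_kernelPow_zero (K : X → X → ℝ) (μ : X → ℝ) :
    kernelPush μ (kernelPow K 0) = μ := by
  funext z
  simp [kernelPush, kernelPow]

theorem kernelPush_kernelPow_succ (hK : ∀ x, IsProbVec (K x)) {μ : X → ℝ} (hμ : IsProbVec μ)
    (m : ℕ) :
    kernelPush μ (kernelPow K (m + 1)) = kernelPush (kernelPush μ (kernelPow K m)) K :=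
  (hμ.kernelPush_assoc (isProbVec_kernelPow hK m) hK).symm

theorem kernelPow_add (hK : ∀ x, IsProbVec (K x)) (n m : ℕ) (x : X) :
    kernelPow K (n + m) x = kernelPush (kernelPow K n x) (kernelPow K m) := by
  induction m with
  | zero => exact (kernelPush_kernelPow_zero K _).symm
  | succ m ih =>
    rw [kernelPush_kernelPow_succ hK (isProbVec_kernelPow hK n x), ← ih]
    rfl

theorem kernelPush_kernelPow_of_stationary (hK : ∀ x, IsProbVec (K x)) {π : X → ℝ}
    (hπ : IsProbVec π) (hstat : kernelPush π K = π) (m : ℕ) :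
    kernelPush π (kernelPow K m) = π := by
  induction m with
  | zero => exact kernelPush_kernelPow_zero K π
  | succ m ih => rw [kernelPush_kernelPow_succ hK hπ, ih, hstat]

end Pow

/-- Lemma `l-hdsub`, discrete time: for an irreducible Markov
chain on a countable set with stationary distribution `π`, the map
`m ↦ 4 d_H(m)` is non-increasing and submultiplicative. -/
theorem hellinger_antitone_submultiplicative (X : Type*) [Countable X] [DecidableEq X]
    (K : X → X → ℝ) (π : X → ℝ)
    (hK0 : ∀ x y, 0 ≤ K x y) (hK1 : ∀ x, ∑' y, K x y = 1)
    (hπ0 : ∀ x, 0 ≤ π x) (hπ1 : ∑' x, π x = 1)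
    (hstat : ∀ y, ∑' x, π x * K x y = π y) :
    Antitone (fun m : ℕ => 4 * hellingerSup (kernelPow K m) π) ∧
    ∀ n m : ℕ, 4 * hellingerSup (kernelPow K (n + m)) π ≤
      (4 * hellingerSup (kernelPow K n) π) * (4 * hellingerSup (kernelPow K m) π) := by
  have isProb : ∀ {μ : X → ℝ}, (∀ x, 0 ≤ μ x) → ∑' x, μ x = 1 → IsProbVec μ := fun h0 h1 =>
    ⟨h0, h1 ▸ (by_contra fun h => by simp [tsum_eq_zero_of_not_summable h] at h1 :
      Summable _).hasSum⟩
  have hK : ∀ x, IsProbVec (K x) := fun x => isProb (hK0 x) (hK1 x)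
  have hπ : IsProbVec π := isProb hπ0 hπ1
  have hπK : kernelPush π K = π := funext hstat
  have hpow := isProbVec_kernelPow hK
  have : Nonempty X := by
    by_contra h
    rw [not_nonempty_iff] at h
    simp at hπ1
  constructor
  · refine antitone_nat_of_succ_le fun m => mul_le_mul_of_nonneg_left ?_ (by norm_num)
    refine ciSup_mono (bddAbove_range_sqrt_hellingerEnergy (hpow m) hπ) fun x => ?_
    refine Real.sqrt_le_sqrt (mul_le_mul_of_nonneg_left ?_ (by norm_num))
    have h := (hpow m x).hellingerEnergy_kernelPush_le hπ hK
    rwa [hπK] at h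
  · intro n m
    set a := hellingerSup (kernelPow K n) π
    set b := hellingerSup (kernelPow K m) π
    have ha : 0 ≤ a := hellingerSup_nonneg _ _
    have hb : 0 ≤ b := hellingerSup_nonneg _ _
    suffices h : hellingerSup (kernelPow K (n + m)) π ≤ 4 * a * b by linarith
    refine ciSup_le fun x => Real.sqrt_le_iff.2 ⟨by positivity, ?_⟩
    have h := (hpow n x).hellingerEnergy_kernelPush_le_mul hπ (hpow m)
      (kernelPush_kernelPow_of_stationary hK hπ hπK m)
      (hellingerEnergy_le_two_mul_hellingerSup_sq (hpow m) hπ)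
    rw [← kernelPow_add hK] at h
    have h' := mul_le_mul_of_nonneg_right
      (hellingerEnergy_le_two_mul_hellingerSup_sq (hpow n) hπ x) (by positivity : 0 ≤ 2 * b ^ 2)
    change 1 / 2 * hellingerEnergy (kernelPow K (n + m) x) π ≤ _
    calc _ ≤ 1 / 2 * (8 * (2 * a ^ 2 * (2 * b ^ 2))) := by linarith
      _ = (4 * a * b) ^ 2 := by ring
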